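/- arXiv:1302.4164 — 2 statements merged into one kernel-verified Lean document; each statement's English description precedes it below -/
import Mathlib

section
/- Let ω, σ be nonnegative Borel measures on ℝ^n, K : D → [0,∞) a map on dyadic cubes, 1 < q < ∞, and F a dyadic cube. Then ∫_F (∑_{Q ⊆ F} K(Q) σ(Q) 1_Q)^q dω ≤ c(q) ∑_{Q ⊆ F} K(Q) σ(Q) ω(Q) ((1/ω(Q)) ∑_{Q' ⊆ Q} K(Q') σ(Q') ω(Q'))^{q-1}, where c(q) = q for 1 < q ≤ 2 and c(q) = (q(q-1)⋯(q-k))^{(q-1)/(q-k-1)} with k = ⌈q-2⌉ for q > 2, and all sums range over dyadic cubes with ω(Q) > 0 and finitely many nonzero terms K(Q)σ(Q). -/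
open MeasureTheory Finset Classical

noncomputable section

def dyadicCube (n : ℕ) (i : ℤ) (k : Fin n → ℤ) : Set (Fin n → ℝ) :=
  {x | ∀ j, (k j : ℝ) * 2 ^ (-i) ≤ x j ∧ x j < ((k j : ℝ) + 1) * 2 ^ (-i)}

def IsDyadicCube (n : ℕ) (Q : Set (Fin n → ℝ)) : Prop :=
  ∃ i k, Q = dyadicCube n i k

/-- The constant `c(s)` of the Cascante–Ortega–Verbitsky lemma:
`c(s) = s` for `1 < s ≤ 2`, and `c(s) = (s(s-1)⋯(s-k))^{(s-1)/(s-k-1)}`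
with `k = ⌈s-2⌉` for `s > 2`. -/
def covConst (s : ℝ) : ℝ :=
  if s ≤ 2 then s
  else (∏ j ∈ Finset.range ((⌈s - 2⌉).toNat + 1), (s - j)) ^
    ((s - 1) / (s - (⌈s - 2⌉).toNat - 1))

theorem add_rpow_le_rpow_add_mul {s A a : ℝ} (hs : 1 ≤ s) (hA : 0 ≤ A) (ha : 0 ≤ a) :
    (A + a) ^ s ≤ A ^ s + s * (a * (A + a) ^ (s - 1)) := by
  rcases (add_nonneg hA ha).eq_or_lt' with h | h
  · obtain rfl : A = 0 := by linarith
    obtain rfl : a = 0 := by linarith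
    simp [Real.zero_rpow (by linarith : s ≠ 0)]
  · have hb := one_add_mul_self_le_rpow_one_add (s := A / (A + a) - 1)
      (by linarith [div_nonneg hA h.le]) hs
    rw [add_sub_cancel, Real.div_rpow hA h.le, le_div_iff₀ (Real.rpow_pos_of_pos h s)] at hb
    have h1 : (A + a) ^ s = (A + a) ^ (s - 1) * (A + a) := by
      rw [← Real.rpow_add_one h.ne', sub_add_cancel]
    have h2 : (1 + s * (A / (A + a) - 1)) * (A + a) ^ s
        = (A + a) ^ s - s * (a * (A + a) ^ (s - 1)) := by
      rw [h1]
      field_simp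
      ring
    linarith

section Chain

variable {α ι : Type*} (E : ι → Set α) (a : ι → ℝ)

theorem rpow_sum_le_of_chain (ha : ∀ i, 0 ≤ a i) {s : ℝ} (hs : 1 ≤ s) (T : Finset ι)
    (hT : ∀ i ∈ T, ∀ j ∈ T, E i ⊆ E j ∨ E j ⊆ E i) :
    (∑ i ∈ T, a i) ^ s ≤ s * ∑ i ∈ T, a i * (∑ j ∈ T with E j ⊆ E i, a j) ^ (s - 1) := by
  induction T using Finset.strongInduction with
  | H T ih =>
    rcases T.eq_empty_or_nonempty with rfl | hne
    · simp [Real.zero_rpow (by linarith : s ≠ 0)]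
    obtain ⟨m, hm, hmax⟩ := Finset.exists_maximalFor E T hne
    have htop : ∀ i ∈ T, E i ⊆ E m := fun i hi =>
      (hT i hi m hm).elim id fun h => hmax hi h
    have hrec := ih (T.erase m) (Finset.erase_ssubset hm) fun i hi j hj =>
      hT i (Finset.mem_of_mem_erase hi) j (Finset.mem_of_mem_erase hj)
    have hstep := add_rpow_le_rpow_add_mul hs
      (Finset.sum_nonneg fun i (_ : i ∈ T.erase m) => ha i) (ha m)
    rw [Finset.sum_erase_add _ _ hm] at hstep
    rw [← Finset.sum_erase_add _ (fun i => a i * (∑ j ∈ T with E j ⊆ E i, a j) ^ (s - 1)) hm,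
      Finset.filter_true_of_mem htop, mul_add]
    refine hstep.trans (add_le_add_left (hrec.trans ?_) _)
    gcongr with i hi
    · exact ha i
    · exact Finset.sum_nonneg fun _ _ => ha _
    · exact fun _ _ _ => ha _
    · exact Finset.erase_subset _ _

theorem rpow_sum_le_iterated_of_chain (ha : ∀ i, 0 ≤ a i) {s : ℝ} (T : Finset ι)
    (hT : ∀ i ∈ T, ∀ j ∈ T, E i ⊆ E j ∨ E j ⊆ E i) (m : ℕ) (hm : 1 ≤ s - m) :
    (∑ i ∈ T, a i) ^ s ≤ (∏ j ∈ Finset.range (m + 1), (s - j)) *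
      ∑ i ∈ T, a i * ((∑ j ∈ T with E i ⊆ E j, a j) ^ m *
        (∑ j ∈ T with E j ⊆ E i, a j) ^ (s - m - 1)) := by
  induction m with
  | zero => simpa using rpow_sum_le_of_chain E a ha (by simpa using hm) T hT
  | succ m ih =>
    push_cast at hm
    refine (ih (by linarith)).trans ?_
    have hC : 0 ≤ ∏ j ∈ Finset.range (m + 1), (s - j) := by
      refine Finset.prod_nonneg fun j hj => ?_
      have : (j : ℝ) ≤ m := by
        exact_mod_cast Nat.le_of_lt_succ (Finset.mem_range.1 hj)
      linarith
    have hsum : ∀ U : Finset ι, 0 ≤ ∑ i ∈ U, a i := fun U => Finset.sum_nonneg fun _ _ => ha _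
    rw [Finset.prod_range_succ _ (m + 1), mul_assoc]
    refine mul_le_mul_of_nonneg_left ?_ hC
    have hlow : ∀ i ∈ T, (∑ j ∈ T with E j ⊆ E i, a j) ^ (s - m - 1) ≤
        (s - (m + 1 : ℕ)) * ∑ l ∈ T with E l ⊆ E i,
          a l * (∑ j ∈ T with E j ⊆ E l, a j) ^ (s - (m + 1 : ℕ) - 1) := by
      intro i _
      have h := rpow_sum_le_of_chain E a ha (s := s - m - 1) (by linarith) (T.filter (E · ⊆ E i))
        fun p hp r hr => hT p (Finset.mem_filter.1 hp).1 r (Finset.mem_filter.1 hr).1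
      have e : s - m - 1 = s - (m + 1 : ℕ) := by push_cast; ring
      rw [e] at h ⊢
      refine h.trans_eq ?_
      congr 1
      refine Finset.sum_congr rfl fun l hl => ?_
      rw [Finset.filter_filter]
      congr 3
      ext j
      have := (Finset.mem_filter.1 hl).2
      simp only [Finset.mem_filter]
      exact ⟨fun h => ⟨h.1, h.2.2⟩, fun h => ⟨h.1, h.2.trans this, h.2⟩⟩
    have hup : ∀ l ∈ T, ∑ i ∈ T with E l ⊆ E i, a i * (∑ j ∈ T with E i ⊆ E j, a j) ^ m ≤
        (∑ j ∈ T with E l ⊆ E j, a j) ^ (m + 1) := by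
      intro l _
      rw [pow_succ', Finset.sum_mul]
      refine Finset.sum_le_sum fun i hi => mul_le_mul_of_nonneg_left ?_ (ha i)
      refine pow_le_pow_left₀ (hsum _) (Finset.sum_le_sum_of_subset_of_nonneg ?_
        fun _ _ _ => ha _) m
      intro j hj
      simp only [Finset.mem_filter] at hi hj ⊢
      exact ⟨hj.1, hi.2.trans hj.2⟩
    calc ∑ i ∈ T, a i * ((∑ j ∈ T with E i ⊆ E j, a j) ^ m *
          (∑ j ∈ T with E j ⊆ E i, a j) ^ (s - m - 1))
        ≤ ∑ i ∈ T, a i * ((∑ j ∈ T with E i ⊆ E j, a j) ^ m *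
          ((s - (m + 1 : ℕ)) * ∑ l ∈ T with E l ⊆ E i,
          a l * (∑ j ∈ T with E j ⊆ E l, a j) ^ (s - (m + 1 : ℕ) - 1))) := by
          refine Finset.sum_le_sum fun i hi => mul_le_mul_of_nonneg_left
            (mul_le_mul_of_nonneg_left (hlow i hi) (pow_nonneg (hsum _) m)) (ha i)
      _ = (s - (m + 1 : ℕ)) * ∑ l ∈ T, (a l * (∑ j ∈ T with E j ⊆ E l, a j) ^
            (s - (m + 1 : ℕ) - 1)) *
            ∑ i ∈ T with E l ⊆ E i, a i * (∑ j ∈ T with E i ⊆ E j, a j) ^ m := by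
          simp only [Finset.mul_sum, Finset.sum_filter]
          rw [Finset.sum_comm]
          refine Finset.sum_congr rfl fun l _ => Finset.sum_congr rfl fun i _ => ?_
          split_ifs <;> ring
      _ ≤ _ := by
          refine mul_le_mul_of_nonneg_left (Finset.sum_le_sum fun l hl => ?_)
            (by push_cast; linarith)
          rw [mul_assoc (a l), mul_comm (_ ^ (m + 1))]
          exact mul_le_mul_of_nonneg_left (mul_le_mul_of_nonneg_left (hup l hl)
            (Real.rpow_nonneg (hsum _) _)) (ha l)

theorem sum_mul_indicator_one_eq (S : Finset ι) (x : α) :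
    ∑ i ∈ S, a i * (E i).indicator 1 x = ∑ i ∈ S with x ∈ E i, a i := by
  simp [Finset.sum_filter, Set.indicator_apply]

end Chain

section Nested

variable {α ι : Type*} [MeasurableSpace α] (μ : Measure α) [IsFiniteMeasure μ]
  {E : ι → Set α} {a : ι → ℝ}

theorem integrable_rpow_sum_indicator (hE : ∀ i, MeasurableSet (E i)) (ha : ∀ i, 0 ≤ a i)
    (T : Finset ι) {r : ℝ} (hr : 0 ≤ r) :
    Integrable (fun x => (∑ i ∈ T, a i * (E i).indicator 1 x) ^ r) μ := by
  have hmeas : Measurable fun x => (∑ i ∈ T, a i * (E i).indicator (1 : α → ℝ) x) ^ r :=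
    (Finset.measurable_sum _ fun i _ =>
      (measurable_one.indicator (hE i)).const_mul (a i)).pow_const r
  have hterm : ∀ i x, 0 ≤ a i * (E i).indicator (1 : α → ℝ) x := fun i x =>
    mul_nonneg (ha i) (Set.indicator_nonneg (fun _ _ => zero_le_one) x)
  refine Integrable.of_bound hmeas.aestronglyMeasurable ((∑ i ∈ T, a i) ^ r)
    (Filter.Eventually.of_forall fun x => ?_)
  have h0 : 0 ≤ ∑ i ∈ T, a i * (E i).indicator (1 : α → ℝ) x :=
    Finset.sum_nonneg fun i _ => hterm i x
  rw [Real.norm_of_nonneg (Real.rpow_nonneg h0 r)]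
  refine Real.rpow_le_rpow h0 (Finset.sum_le_sum fun i _ => ?_) hr
  exact mul_le_of_le_one_right (ha i) (Set.indicator_le_self' (fun _ _ => zero_le_one) x)

theorem setIntegral_rpow_sum_indicator_le (hE : ∀ i, MeasurableSet (E i)) (ha : ∀ i, 0 ≤ a i)
    (T : Finset ι) {A : Set α} (hA : 0 < μ.real A) (hTA : ∀ i ∈ T, E i ⊆ A)
    {r : ℝ} (hr : 0 ≤ r) (hr' : r ≤ 1) :
    ∫ x in A, (∑ i ∈ T, a i * (E i).indicator 1 x) ^ r ∂μ ≤
      μ.real A * (1 / μ.real A * ∑ i ∈ T, a i * μ.real (E i)) ^ r := by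
  have hint := integrable_rpow_sum_indicator (E := E) (a := a) μ hE ha T zero_le_one
  simp only [Real.rpow_one] at hint
  have hj := (Real.concaveOn_rpow hr hr').le_map_set_average (μ := μ) (t := A)
    (f := fun x => ∑ i ∈ T, a i * (E i).indicator 1 x)
    (Real.continuous_rpow_const hr).continuousOn isClosed_Ici
    (fun h => by simp [Measure.real, h] at hA) (measure_ne_top _ _)
    (Filter.Eventually.of_forall fun x => Finset.sum_nonneg fun i _ =>
      mul_nonneg (ha i) (Set.indicator_nonneg (fun _ _ => zero_le_one) x))
    hint.integrableOn (integrable_rpow_sum_indicator μ hE ha T hr).integrableOn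
  rw [setAverage_eq, setAverage_eq, smul_eq_mul, smul_eq_mul, inv_mul_le_iff₀ hA] at hj
  have hval : ∫ x in A, ∑ i ∈ T, a i * (E i).indicator 1 x ∂μ = ∑ i ∈ T, a i * μ.real (E i) := by
    rw [integral_finsetSum]
    · refine Finset.sum_congr rfl fun i hi => ?_
      rw [integral_const_mul, integral_indicator_one (hE i), measureReal_restrict_apply (hE i),
        Set.inter_eq_left.2 (hTA i hi)]
    · exact fun i _ => (((integrable_const (1 : ℝ)).indicator (hE i)).const_mul (a i)).integrableOn
  rw [one_div, ← hval]
  exact hj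

theorem integral_rpow_sum_indicator_le_of_nested (hE : ∀ i, MeasurableSet (E i))
    (ha : ∀ i, 0 ≤ a i) (S : Finset ι)
    (hnest : ∀ i ∈ S, ∀ j ∈ S, ∀ x ∈ E i, x ∈ E j → E i ⊆ E j ∨ E j ⊆ E i)
    (hμ : ∀ i ∈ S, 0 < μ.real (E i)) {q : ℝ} (k : ℕ)
    (hk : 0 < q - k - 1) (hk' : q - k - 1 ≤ 1) :
    ∫ x, (∑ i ∈ S, a i * (E i).indicator 1 x) ^ q ∂μ ≤
      (∏ j ∈ Finset.range (k + 1), (q - j)) ^ ((q - 1) / (q - k - 1)) *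
        ∑ i ∈ S, a i * μ.real (E i) *
          (1 / μ.real (E i) * ∑ j ∈ S with E j ⊆ E i, a j * μ.real (E j)) ^ (q - 1) := by
  have hk0 : (0 : ℝ) ≤ k := k.cast_nonneg
  have hq1 : 0 < q - 1 := by linarith
  set C : ℝ := ∏ j ∈ Finset.range (k + 1), (q - j)
  have hC : 0 ≤ C := by
    refine Finset.prod_nonneg fun j hj => ?_
    have : (j : ℝ) ≤ k := by
      exact_mod_cast Nat.le_of_lt_succ (Finset.mem_range.1 hj)
    linarith
  set θ : ℝ := q - k - 1 with hθ
  set u : ι → ℝ := fun i => ∑ j ∈ S with E i ⊆ E j, a j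
  set A : ι → ℝ := fun i => 1 / μ.real (E i) * ∑ j ∈ S with E j ⊆ E i, a j * μ.real (E j)
  set f : α → ℝ := fun x => ∑ i ∈ S, a i * (E i).indicator 1 x with hf
  set g : ι → α → ℝ := fun i x => ∑ j ∈ S with E j ⊆ E i, a j * (E j).indicator 1 x with hg
  have hu0 : ∀ i, 0 ≤ u i := fun i => Finset.sum_nonneg fun _ _ => ha _
  have hA0 : ∀ i, 0 ≤ A i := fun i => mul_nonneg (by positivity)
    (Finset.sum_nonneg fun j _ => mul_nonneg (ha j) measureReal_nonneg)
  have hfint : Integrable (fun x => f x ^ q) μ :=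
    integrable_rpow_sum_indicator μ hE ha S (by linarith)
  have hgint : ∀ i, Integrable (fun x => g i x ^ θ) μ := fun i =>
    integrable_rpow_sum_indicator μ hE ha _ hk.le
  have hufx : ∀ x, ∀ i ∈ S, x ∈ E i → u i = ∑ j ∈ S with x ∈ E j ∧ E i ⊆ E j, a j := by
    intro x i _ hx
    refine Finset.sum_congr ?_ fun _ _ => rfl
    ext j
    simp only [Finset.mem_filter]
    exact ⟨fun h => ⟨h.1, h.2 hx, h.2⟩, fun h => ⟨h.1, h.2.2⟩⟩
  have hpoint : ∀ x, f x ^ q ≤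
      C * ∑ i ∈ S, a i * (u i ^ k * (E i).indicator (fun x => g i x ^ θ) x) := by
    intro x
    have h := rpow_sum_le_iterated_of_chain E a ha (s := q) (S.filter (x ∈ E ·))
      (fun i hi j hj => hnest i (Finset.mem_filter.1 hi).1 j (Finset.mem_filter.1 hj).1 x
        (Finset.mem_filter.1 hi).2 (Finset.mem_filter.1 hj).2) k (by linarith)
    rw [← sum_mul_indicator_one_eq] at h
    refine h.trans_eq ?_
    congr 1
    rw [Finset.sum_filter]
    refine Finset.sum_congr rfl fun i hi => ?_
    split_ifs with hx
    · rw [Set.indicator_of_mem hx, hufx x i hi hx, Finset.filter_filter, Finset.filter_filter]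
      simp only [hg]
      rw [sum_mul_indicator_one_eq, Finset.filter_filter]
      simp only [and_comm, hθ]
    · simp [hx]
  have hint1 : ∫ x, f x ^ q ∂μ ≤ C * ∑ i ∈ S, a i * (u i ^ k * (μ.real (E i) * A i ^ θ)) := by
    have hi : ∀ i, Integrable
        (fun x => a i * (u i ^ k * (E i).indicator (fun x => g i x ^ θ) x)) μ :=
      fun i => (((hgint i).indicator (hE i)).const_mul _).const_mul _
    refine (integral_mono hfint
      ((integrable_finsetSum S fun i _ => hi i).const_mul C) hpoint).trans ?_
    rw [integral_const_mul, integral_finsetSum _ fun i _ => hi i]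
    refine mul_le_mul_of_nonneg_left (Finset.sum_le_sum fun i hiS => ?_) hC
    rw [integral_const_mul, integral_const_mul, integral_indicator (hE i)]
    refine mul_le_mul_of_nonneg_left (mul_le_mul_of_nonneg_left ?_ (pow_nonneg (hu0 i) k)) (ha i)
    exact setIntegral_rpow_sum_indicator_le μ hE ha _ (hμ i hiS)
      (fun j hj => (Finset.mem_filter.1 hj).2) hk.le hk'
  have hint2 : ∑ i ∈ S, a i * (μ.real (E i) * u i ^ (q - 1)) ≤ ∫ x, f x ^ q ∂μ := by
    have hi : ∀ i, Integrable (fun x => a i * ((E i).indicator (fun _ => u i ^ (q - 1)) x)) μ :=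
      fun i => ((integrable_const _).indicator (hE i)).const_mul _
    have : ∫ x, ∑ i ∈ S, a i * ((E i).indicator (fun _ => u i ^ (q - 1)) x) ∂μ
        = ∑ i ∈ S, a i * (μ.real (E i) * u i ^ (q - 1)) := by
      rw [integral_finsetSum _ fun i _ => hi i]
      refine Finset.sum_congr rfl fun i _ => ?_
      rw [integral_const_mul, integral_indicator_const _ (hE i), smul_eq_mul]
    rw [← this]
    refine integral_mono (integrable_finsetSum S fun i _ => hi i) hfint fun x => ?_
    have hfx : f x = ∑ i ∈ S with x ∈ E i, a i := sum_mul_indicator_one_eq E a S x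
    have hfx0 : 0 ≤ f x := hfx ▸ Finset.sum_nonneg fun _ _ => ha _
    have hsplit : f x ^ q = f x * f x ^ (q - 1) := by
      rw [← Real.rpow_one_add' hfx0 (by linarith), add_sub_cancel]
    change _ ≤ f x ^ q
    rw [hsplit]
    nth_rw 1 [hf]
    rw [Finset.sum_mul]
    refine Finset.sum_le_sum fun i hiS => ?_
    rw [mul_assoc]
    refine mul_le_mul_of_nonneg_left ?_ (ha i)
    by_cases hx : x ∈ E i
    · simp only [Set.indicator_of_mem hx, Pi.one_apply, one_mul]
      refine Real.rpow_le_rpow (hu0 i) ?_ hq1.le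
      rw [hfx, hufx x i hiS hx]
      exact Finset.sum_le_sum_of_subset_of_nonneg
        (Finset.monotone_filter_right _ fun _ _ h => h.1) fun _ _ _ => ha _
    · simp [hx]
  set D : ℝ := C ^ ((q - 1) / θ)
  have hyoung : ∀ i, C * (u i ^ k * A i ^ θ) ≤
      θ / (q - 1) * (D * A i ^ (q - 1)) + k / (q - 1) * u i ^ (q - 1) := by
    intro i
    have h := Real.geom_mean_le_arith_mean2_weighted (w₁ := θ / (q - 1)) (w₂ := k / (q - 1))
      (p₁ := D * A i ^ (q - 1)) (p₂ := u i ^ (q - 1)) (by positivity) (by positivity)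
      (mul_nonneg (Real.rpow_nonneg hC _) (Real.rpow_nonneg (hA0 i) _))
      (Real.rpow_nonneg (hu0 i) _) (by rw [hθ]; field_simp; ring)
    refine le_trans (le_of_eq ?_) h
    rw [Real.mul_rpow (Real.rpow_nonneg hC _) (Real.rpow_nonneg (hA0 i) _),
      ← Real.rpow_mul hC, ← Real.rpow_mul (hA0 i), ← Real.rpow_mul (hu0 i),
      div_mul_div_cancel₀ hk.ne', div_self hq1.ne', mul_div_cancel₀ _ hq1.ne',
      mul_div_cancel₀ _ hq1.ne', Real.rpow_one, Real.rpow_natCast]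
    ring
  set X := ∫ x, f x ^ q ∂μ
  set Y := ∑ i ∈ S, a i * μ.real (E i) * A i ^ (q - 1) with hY
  have hfin : X ≤ θ / (q - 1) * (D * Y) + k / (q - 1) * X := by
    refine hint1.trans (le_trans ?_ (add_le_add_right
      (mul_le_mul_of_nonneg_left hint2 (by positivity)) _))
    simp only [hY, Finset.mul_sum]
    rw [← Finset.sum_add_distrib]
    refine Finset.sum_le_sum fun i _ => ?_
    have := mul_le_mul_of_nonneg_left (hyoung i)
      (mul_nonneg (ha i) (measureReal_nonneg (μ := μ) (s := E i)))
    linarith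
  have hXY : θ * X ≤ θ * (D * Y) := by
    have h := mul_le_mul_of_nonneg_left hfin hq1.le
    have e : (q - 1) * (θ / (q - 1) * (D * Y) + k / (q - 1) * X) = θ * (D * Y) + k * X := by
      field_simp
    rw [e] at h
    have : θ * X = (q - 1) * X - k * X := by rw [hθ]; ring
    linarith
  exact le_of_mul_le_mul_left hXY hk

end Nested

theorem dyadicCube_subset_of_mem {n : ℕ} {i i' : ℤ} {k k' : Fin n → ℤ} (hi : i ≤ i')
    {x : Fin n → ℝ} (hx : x ∈ dyadicCube n i k) (hx' : x ∈ dyadicCube n i' k') :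
    dyadicCube n i' k' ⊆ dyadicCube n i k := by
  intro y hy j
  obtain ⟨d, rfl⟩ := Int.le.dest hi
  obtain ⟨h1, h2⟩ := hx j
  obtain ⟨h3, h4⟩ := hx' j
  obtain ⟨h5, h6⟩ := hy j
  have hs : (0 : ℝ) < 2 ^ (-(i + d)) := by positivity
  have hscale : (2 : ℝ) ^ (-i) = ((2 ^ d : ℤ) : ℝ) * 2 ^ (-(i + d)) := by
    push_cast
    rw [← zpow_natCast, ← zpow_add₀ two_ne_zero]
    congr 1
    ring
  rw [hscale, ← mul_assoc] at h1 h2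
  rw [hscale, ← mul_assoc, ← mul_assoc]
  have hlo : k j * 2 ^ d < k' j + 1 := by
    have := lt_of_mul_lt_mul_right (h1.trans_lt h4) hs.le
    exact_mod_cast this
  have hhi : k' j < (k j + 1) * 2 ^ d := by
    have := lt_of_mul_lt_mul_right (h3.trans_lt h2) hs.le
    exact_mod_cast this
  have hlo' : (k j : ℝ) * ((2 ^ d : ℤ) : ℝ) ≤ k' j := by
    exact_mod_cast Int.le_of_lt_add_one hlo
  have hhi' : (k' j : ℝ) + 1 ≤ ((k j : ℝ) + 1) * ((2 ^ d : ℤ) : ℝ) := by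
    exact_mod_cast Int.add_one_le_of_lt hhi
  exact ⟨(mul_le_mul_of_nonneg_right hlo' hs.le).trans h5,
    h6.trans_le (mul_le_mul_of_nonneg_right hhi' hs.le)⟩

theorem dyadicCube_eq_pi (n : ℕ) (i : ℤ) (k : Fin n → ℤ) :
    dyadicCube n i k =
      Set.univ.pi fun j => Set.Ico ((k j : ℝ) * 2 ^ (-i)) (((k j : ℝ) + 1) * 2 ^ (-i)) := by
  ext x
  simp [dyadicCube]

theorem measurableSet_dyadicCube (n : ℕ) (i : ℤ) (k : Fin n → ℤ) :
    MeasurableSet (dyadicCube n i k) := by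
  rw [dyadicCube_eq_pi]
  exact MeasurableSet.univ_pi fun _ => measurableSet_Ico

theorem measure_dyadicCube_lt_top (n : ℕ) (i : ℤ) (k : Fin n → ℤ) (μ : Measure (Fin n → ℝ))
    [IsLocallyFiniteMeasure μ] : μ (dyadicCube n i k) < ⊤ := by
  rw [dyadicCube_eq_pi]
  exact (measure_mono (Set.pi_mono fun _ _ => Set.Ico_subset_Icc_self)).trans_lt
    (isCompact_univ_pi fun _ => isCompact_Icc).measure_lt_top

theorem covConst_eq {q : ℝ} (hq : 1 < q) :
    covConst q = (∏ j ∈ Finset.range ((⌈q - 2⌉).toNat + 1), (q - j)) ^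
      ((q - 1) / (q - (⌈q - 2⌉).toNat - 1)) := by
  unfold covConst
  split_ifs with h
  · have h0 : (⌈q - 2⌉).toNat = 0 := Int.toNat_of_nonpos (Int.ceil_le.2 (by simpa using h))
    rw [h0]
    simp [div_self (sub_pos.2 hq).ne']
  · rfl

theorem toNat_ceil_sub_two_bounds {q : ℝ} (hq : 1 < q) :
    0 < q - (⌈q - 2⌉).toNat - 1 ∧ q - (⌈q - 2⌉).toNat - 1 ≤ 1 := by
  have h0 : 0 ≤ ⌈q - 2⌉ := Int.le_ceil_iff.2 (by push_cast; linarith)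
  have hc : (((⌈q - 2⌉).toNat : ℕ) : ℝ) = (⌈q - 2⌉ : ℝ) := by
    exact_mod_cast Int.toNat_of_nonneg h0
  rw [hc]
  constructor <;> linarith [Int.le_ceil (q - 2), Int.ceil_lt_add_one (q - 2)]

theorem A1_le_A2_for_dyadic_operator (n : ℕ) (σ ω : Measure (Fin n → ℝ))
    [IsLocallyFiniteMeasure σ] [IsLocallyFiniteMeasure ω]
    (q : ℝ) (hq : 1 < q) (F : Set (Fin n → ℝ)) (hF : IsDyadicCube n F)
    (S : Finset (ℤ × (Fin n → ℤ))) (hS : ∀ p ∈ S, dyadicCube n p.1 p.2 ⊆ F)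
    (K : ℤ × (Fin n → ℤ) → ℝ) (hK : ∀ p, 0 ≤ K p)
    (hω : ∀ p ∈ S, 0 < (ω (dyadicCube n p.1 p.2)).toReal) :
    ∫ x in F, (∑ p ∈ S, K p * (σ (dyadicCube n p.1 p.2)).toReal *
        (dyadicCube n p.1 p.2).indicator 1 x) ^ q ∂ω ≤
      covConst q * ∑ p ∈ S,
        K p * (σ (dyadicCube n p.1 p.2)).toReal * (ω (dyadicCube n p.1 p.2)).toReal *
          ((1 / (ω (dyadicCube n p.1 p.2)).toReal) *
            ∑ p' ∈ S.filter fun p' => dyadicCube n p'.1 p'.2 ⊆ dyadicCube n p.1 p.2,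
              K p' * (σ (dyadicCube n p'.1 p'.2)).toReal *
                (ω (dyadicCube n p'.1 p'.2)).toReal) ^ (q - 1) := by
  obtain ⟨i₀, k₀, rfl⟩ := hF
  have : IsFiniteMeasure (ω.restrict (dyadicCube n i₀ k₀)) :=
    isFiniteMeasure_restrict.2 (measure_dyadicCube_lt_top n i₀ k₀ ω).ne
  have hreal : ∀ p ∈ S, (ω.restrict (dyadicCube n i₀ k₀)).real (dyadicCube n p.1 p.2) =
      (ω (dyadicCube n p.1 p.2)).toReal := fun p hp => by
    rw [measureReal_restrict_apply (measurableSet_dyadicCube n p.1 p.2),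
      Set.inter_eq_left.2 (hS p hp), measureReal_def]
  obtain ⟨hk, hk'⟩ := toNat_ceil_sub_two_bounds hq
  have hmain := integral_rpow_sum_indicator_le_of_nested (ω.restrict (dyadicCube n i₀ k₀))
    (E := fun p : ℤ × (Fin n → ℤ) => dyadicCube n p.1 p.2)
    (a := fun p => K p * (σ (dyadicCube n p.1 p.2)).toReal)
    (fun p => measurableSet_dyadicCube n p.1 p.2)
    (fun p => mul_nonneg (hK p) ENNReal.toReal_nonneg) S
    (fun p _ p' _ x hx hx' => (le_total p.1 p'.1).symm.imp
      (fun h => dyadicCube_subset_of_mem h hx' hx) fun h => dyadicCube_subset_of_mem h hx hx')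
    (fun p hp => (hreal p hp).symm ▸ hω p hp) (⌈q - 2⌉).toNat hk hk'
  rw [← covConst_eq hq] at hmain
  refine hmain.trans_eq ?_
  congr 1
  refine Finset.sum_congr rfl fun p hp => ?_
  rw [hreal p hp]
  congr 3
  exact Finset.sum_congr rfl fun p' hp' => by rw [hreal p' (Finset.mem_filter.1 hp').1]

end
end

section
/- Let σ, ω be nonnegative locally finite Borel measures on ℝ^n, K : D → [0,∞), 1 < q < p < ∞, 1/q = 1/r + 1/p, and suppose the trace inequality ‖T_K[f dσ]‖_{L^q(dω)} ≤ C_1 ‖f‖_{L^p(dσ)} holds for all nonnegative f ∈ L^p(dσ), where T_K[f dσ] = ∑_{Q ∈ D} K(Q)(∫_Q f dσ) 1_Q. Then ‖(W^q_{K,ω}[σ])^{1/q}‖_{L^r(dσ)} ≤ C C_1, where W^q_{K,ω}[σ](x) = ∑_{Q ∈ D} K(Q) ω(Q) ((1/ω(Q)) ∑_{Q' ⊆ Q} K(Q') ω(Q') σ(Q'))^{q-1} 1_Q(x) and C depends only on p, q, n. -/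
open MeasureTheory ENNReal Classical

noncomputable section

def cube (n : ℕ) (P : ℤ × (Fin n → ℤ)) : Set (Fin n → ℝ) := dyadicCube n P.1 P.2

/-- `W^q_{K,ω}[σ](x) = ∑_Q K(Q) ω(Q) ((1/ω(Q)) ∑_{Q'⊆Q} K(Q') ω(Q') σ(Q'))^{q-1} 1_Q(x)`;
terms with `ω(Q) = 0` vanish since they carry the factor `ω(Q)`. -/
def wolffPot (n : ℕ) (K : ℤ × (Fin n → ℤ) → ℝ≥0∞) (ω σ : Measure (Fin n → ℝ))
    (q : ℝ) (x : Fin n → ℝ) : ℝ≥0∞ :=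
  ∑' P : ℤ × (Fin n → ℤ), (cube n P).indicator
    (fun _ => K P * ω (cube n P) *
      ((∑' P' : ℤ × (Fin n → ℤ),
          if cube n P' ⊆ cube n P then K P' * ω (cube n P') * σ (cube n P') else 0) /
        ω (cube n P)) ^ (q - 1)) x

section LayerCake

lemma lintegral_Ioo_rpow_sub_one {s : ℝ} (hs : 0 < s) {b : ℝ} (hb : 0 ≤ b) :
    ∫⁻ t in Set.Ioo 0 b, ENNReal.ofReal (t ^ (s - 1)) = ENNReal.ofReal (b ^ s / s) := by
  have hint : IntervalIntegrable (fun t : ℝ => t ^ (s - 1)) volume 0 b :=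
    intervalIntegral.intervalIntegrable_rpow' (by linarith)
  rw [restrict_Ioo_eq_restrict_Ioc, ← ofReal_integral_eq_lintegral_ofReal,
    ← intervalIntegral.integral_of_le hb, integral_rpow (Or.inl (by linarith))]
  · simp [Real.zero_rpow hs.ne']
  · exact (intervalIntegrable_iff_integrableOn_Ioc_of_le hb).1 hint
  · filter_upwards [ae_restrict_mem measurableSet_Ioc] with t ht
    exact Real.rpow_nonneg ht.1.le _

/-- The layer cake formula for a single number in `[0, ∞]`. -/
lemma lintegral_Ioi_ite_rpow_sub_one {s : ℝ} (hs : 0 < s) (y : ℝ≥0∞) :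
    ∫⁻ t in Set.Ioi (0 : ℝ),
      (if ENNReal.ofReal t < y then ENNReal.ofReal (t ^ (s - 1)) else 0) =
      y ^ s / ENNReal.ofReal s := by
  have key : ∀ b : ℝ, 0 ≤ b → ∫⁻ t in Set.Ioi (0 : ℝ),
      (if ENNReal.ofReal t < ENNReal.ofReal b then ENNReal.ofReal (t ^ (s - 1)) else 0) =
      ENNReal.ofReal b ^ s / ENNReal.ofReal s := by
    intro b hb
    rw [ENNReal.ofReal_rpow_of_nonneg hb hs.le, ← ENNReal.ofReal_div_of_pos hs,
      ← lintegral_Ioo_rpow_sub_one hs hb, ← lintegral_indicator measurableSet_Ioi,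
      ← lintegral_indicator measurableSet_Ioo]
    congr 1 with t
    by_cases ht : 0 < t
    · by_cases htb : t < b
      · simp [ht, htb, ENNReal.ofReal_lt_ofReal_iff (ht.trans htb), Set.indicator]
      · simp [ht, htb, Set.indicator, ENNReal.ofReal_le_ofReal (not_lt.1 htb)]
    · simp [ht, Set.indicator]
  rcases eq_or_ne y ⊤ with rfl | hy
  · have hle : ∀ b : NNReal, ((b : ℝ≥0∞) ^ s / ENNReal.ofReal s) ≤ ∫⁻ t in Set.Ioi (0 : ℝ),
        (if ENNReal.ofReal t < ⊤ then ENNReal.ofReal (t ^ (s - 1)) else 0) := by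
      intro b
      have := key b b.2
      rw [ENNReal.ofReal_coe_nnreal] at this
      rw [← this]
      refine lintegral_mono fun t => ?_
      dsimp only
      split_ifs with h1 h2
      · exact le_rfl
      · simp at h2
      · exact zero_le
      · exact le_rfl
    rw [ENNReal.top_rpow_of_pos hs, ENNReal.top_div_of_ne_top ENNReal.ofReal_ne_top]
    refine ENNReal.eq_top_of_forall_nnreal_le fun c => ?_
    have hs' : ENNReal.ofReal s ≠ 0 := by simpa using hs
    refine le_trans ?_ (hle ((c * s.toNNReal) ^ (1 / s)))
    rw [ENNReal.coe_rpow_of_nonneg _ (by positivity), ← ENNReal.rpow_mul,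
      one_div_mul_cancel hs.ne', ENNReal.rpow_one, ENNReal.coe_mul]
    exact (ENNReal.mul_div_cancel_right hs' ENNReal.ofReal_ne_top).ge
  · simpa [ENNReal.ofReal_toReal hy] using key y.toReal ENNReal.toReal_nonneg

end LayerCake

section MaximalFunction

variable {α ι : Type*} [MeasurableSpace α]

/-- The maximal function of `g` over a family of sets `S`, with averages taken against `μ`. -/
def maximalFun (S : ι → Set α) (μ : Measure α) (g : α → ℝ≥0∞) (x : α) : ℝ≥0∞ :=
  ⨆ i, (S i).indicator (fun _ => (∫⁻ y in S i, g y ∂μ) / μ (S i)) x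

lemma measurable_maximalFun [Countable ι] {S : ι → Set α} (hS : ∀ i, MeasurableSet (S i))
    (μ : Measure α) (g : α → ℝ≥0∞) : Measurable (maximalFun S μ g) :=
  Measurable.iSup fun i => measurable_const.indicator (hS i)

lemma average_le_maximalFun (S : ι → Set α) (μ : Measure α) (g : α → ℝ≥0∞) {i : ι} {x : α}
    (hx : x ∈ S i) : (∫⁻ y in S i, g y ∂μ) / μ (S i) ≤ maximalFun S μ g x := by
  refine le_trans ?_ (le_iSup _ i)
  simp [hx]

lemma lt_maximalFun_iff {S : ι → Set α} {μ : Measure α} {g : α → ℝ≥0∞} {x : α} {t : ℝ≥0∞} :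
    t < maximalFun S μ g x ↔ ∃ i, x ∈ S i ∧ t < (∫⁻ y in S i, g y ∂μ) / μ (S i) := by
  rw [maximalFun, lt_iSup_iff]
  refine exists_congr fun i => ?_
  by_cases hx : x ∈ S i <;> simp [hx]

lemma mul_measure_biUnion_le_lintegral {S : ι → Set α} (hS : ∀ i, MeasurableSet (S i))
    (hnest : ∀ i j, S i ⊆ S j ∨ S j ⊆ S i ∨ Disjoint (S i) (S j)) (μ : Measure α)
    (g : α → ℝ≥0∞) (t : ℝ≥0∞) (s : Finset ι)
    (h : ∀ i ∈ s, t * μ (S i) ≤ ∫⁻ y in S i, g y ∂μ) :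
    t * μ (⋃ i ∈ s, S i) ≤ ∫⁻ y in ⋃ i ∈ s, S i, g y ∂μ := by
  induction s using Finset.strongInduction with
  | H s ih =>
    rcases s.eq_empty_or_nonempty with rfl | hne
    · simp
    obtain ⟨m, hms, hmax⟩ := s.exists_maximalFor S hne
    set u := s.filter fun i => Disjoint (S i) (S m)
    have hdisj : Disjoint (⋃ i ∈ u, S i) (S m) := by
      simp only [Set.disjoint_iUnion_left]
      intro i hi
      exact (Finset.mem_filter.1 hi).2
    rcases (S m).eq_empty_or_nonempty with hem | ⟨x, hx⟩
    · have hall : ∀ i ∈ s, S i = ∅ := fun i hi => by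
        have := hmax hi (by simp [hem])
        simpa [hem] using this
      have : (⋃ i ∈ s, S i) = ∅ := by simpa using hall
      simp [this]
    have hus : u ⊂ s := by
      refine Finset.filter_ssubset.2 ⟨m, hms, fun hd => ?_⟩
      exact Set.disjoint_left.1 hd hx hx
    have hun : (⋃ i ∈ s, S i) = (⋃ i ∈ u, S i) ∪ S m := by
      apply Set.Subset.antisymm
      · refine Set.iUnion₂_subset fun i hi => ?_
        rcases hnest i m with h1 | h1 | h1
        · exact h1.trans Set.subset_union_right
        · exact (hmax hi h1).trans Set.subset_union_right
        · exact (Set.subset_biUnion_of_mem (u := S)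
            (Finset.mem_filter.2 ⟨hi, h1⟩ : i ∈ u)).trans Set.subset_union_left
      · refine Set.union_subset (Set.iUnion₂_subset fun i hi => ?_) ?_
        · exact Set.subset_biUnion_of_mem (u := S) (hus.1 hi)
        · exact Set.subset_biUnion_of_mem (u := S) hms
    rw [hun, measure_union hdisj (hS m), lintegral_union (hS m) hdisj, mul_add]
    exact add_le_add (ih u hus fun i hi => h i (hus.1 hi)) (h m hms)

lemma mul_measure_iUnion_le_lintegral [Countable ι] {S : ι → Set α}
    (hS : ∀ i, MeasurableSet (S i))
    (hnest : ∀ i j, S i ⊆ S j ∨ S j ⊆ S i ∨ Disjoint (S i) (S j)) (μ : Measure α)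
    (g : α → ℝ≥0∞) (t : ℝ≥0∞) (h : ∀ i, t * μ (S i) ≤ ∫⁻ y in S i, g y ∂μ) :
    t * μ (⋃ i, S i) ≤ ∫⁻ y, g y ∂μ := by
  have hdir : Directed (· ⊆ ·) fun s : Finset ι => ⋃ i ∈ s, S i :=
    Monotone.directed_le fun s s' hss => Set.biUnion_subset_biUnion_left hss
  rw [Set.iUnion_eq_iUnion_finset, hdir.measure_iUnion, ENNReal.mul_iSup]
  exact iSup_le fun s => (mul_measure_biUnion_le_lintegral hS hnest μ g t s
    fun i _ => h i).trans (setLIntegral_le_lintegral _ _)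

/-- The weak type estimate for the maximal function, with the integral localised to the set where
the function is large. -/
lemma mul_measure_lt_maximalFun_le [Countable ι] {S : ι → Set α}
    (hS : ∀ i, MeasurableSet (S i))
    (hnest : ∀ i j, S i ⊆ S j ∨ S j ⊆ S i ∨ Disjoint (S i) (S j)) {μ : Measure α}
    (hfin : ∀ i, μ (S i) ≠ ⊤) (g : α → ℝ≥0∞) {t : ℝ≥0∞} (ht : t ≠ ⊤) :
    t * μ {x | 2 * t < maximalFun S μ g x} ≤ ∫⁻ x, {x | t < g x}.indicator g x ∂μ := by
  set I : Set ι := {i | 2 * t < (∫⁻ y in S i, g y ∂μ) / μ (S i)}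
  have hset : {x | 2 * t < maximalFun S μ g x} = ⋃ i : I, S i := by
    ext x
    simp only [Set.mem_ofPred_eq, lt_maximalFun_iff, Set.mem_iUnion, Subtype.exists, I]
    exact exists_congr fun i => by simp [and_comm]
  rw [hset]
  refine mul_measure_iUnion_le_lintegral (fun i : I => hS i) (fun i j => hnest i j) μ _ t ?_
  rintro ⟨i, hi⟩
  have h1 : 2 * t * μ (S i) ≤ ∫⁻ y in S i, g y ∂μ := ENNReal.mul_le_of_le_div (le_of_lt hi)
  have h2 : ∫⁻ y in S i, g y ∂μ ≤
      t * μ (S i) + ∫⁻ y in S i, {x | t < g x}.indicator g y ∂μ := by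
    rw [← setLIntegral_const, ← lintegral_add_left measurable_const]
    refine lintegral_mono fun y => ?_
    by_cases hy : t < g y
    · simp [hy]
    · simp [hy, not_lt.1 hy]
  have h3 := h1.trans h2
  rw [two_mul, add_mul] at h3
  exact (ENNReal.add_le_add_iff_left (ENNReal.mul_ne_top ht (hfin i))).1 h3

/-- The strong type `(p, p)` estimate for the maximal function over a nested family. -/
lemma lintegral_maximalFun_rpow_le [Countable ι] {S : ι → Set α}
    (hS : ∀ i, MeasurableSet (S i))
    (hnest : ∀ i j, S i ⊆ S j ∨ S j ⊆ S i ∨ Disjoint (S i) (S j)) {μ : Measure α} [SFinite μ]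
    (hfin : ∀ i, μ (S i) ≠ ⊤) {g : α → ℝ≥0∞} (hg : Measurable g) {p : ℝ} (hp : 1 < p) :
    ∫⁻ x, maximalFun S μ g x ^ p ∂μ ≤
      2 ^ p * (ENNReal.ofReal p / ENNReal.ofReal (p - 1)) * ∫⁻ x, g x ^ p ∂μ := by
  have hp0 : 0 < p := by linarith
  have hp1 : 0 < p - 1 := by linarith
  have hM := measurable_maximalFun hS μ g
  have hP0 : ENNReal.ofReal p ≠ 0 := by simpa using hp0
  have hpt : ∀ x, maximalFun S μ g x ^ p = 2 ^ p * ENNReal.ofReal p *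
      ∫⁻ t in Set.Ioi (0 : ℝ), (if 2 * ENNReal.ofReal t < maximalFun S μ g x then
        ENNReal.ofReal (t ^ (p - 1)) else 0) := by
    intro x
    have h2 : ∀ t : ℝ, 2 * ENNReal.ofReal t < maximalFun S μ g x ↔
        ENNReal.ofReal t < maximalFun S μ g x / 2 := fun t => by
      rw [ENNReal.lt_div_iff_mul_lt (by simp) (by simp), mul_comm]
    simp only [h2]
    rw [lintegral_Ioi_ite_rpow_sub_one hp0, mul_assoc,
      ENNReal.mul_div_cancel hP0 ENNReal.ofReal_ne_top,
      ← ENNReal.mul_rpow_of_nonneg _ _ hp0.le, ENNReal.mul_div_cancel (by simp) (by simp)]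
  have hmeas1 : Measurable (Function.uncurry fun (x : α) (t : ℝ) =>
      if 2 * ENNReal.ofReal t < maximalFun S μ g x then
        ENNReal.ofReal (t ^ (p - 1)) else 0) := by
    refine Measurable.ite (measurableSet_lt (by fun_prop) (hM.comp measurable_fst)) ?_
      measurable_const
    fun_prop
  have hmeas2 : Measurable (Function.uncurry fun (t : ℝ) (x : α) =>
      if ENNReal.ofReal t < g x then g x * ENNReal.ofReal (t ^ (p - 1 - 1)) else 0) := by
    refine Measurable.ite (measurableSet_lt (by fun_prop) (hg.comp measurable_snd)) ?_
      measurable_const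
    fun_prop
  have hlayer : ∀ t ∈ Set.Ioi (0 : ℝ),
      ∫⁻ x, (if 2 * ENNReal.ofReal t < maximalFun S μ g x then
        ENNReal.ofReal (t ^ (p - 1)) else 0) ∂μ ≤
      ∫⁻ x, (if ENNReal.ofReal t < g x then
        g x * ENNReal.ofReal (t ^ (p - 1 - 1)) else 0) ∂μ := by
    intro t ht
    have ht0 : 0 < t := ht
    have e1 : ∫⁻ x, (if 2 * ENNReal.ofReal t < maximalFun S μ g x then
        ENNReal.ofReal (t ^ (p - 1)) else 0) ∂μ =
        ENNReal.ofReal (t ^ (p - 1)) * μ {x | 2 * ENNReal.ofReal t < maximalFun S μ g x} := by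
      rw [← lintegral_indicator_const (measurableSet_lt measurable_const hM)]
      refine lintegral_congr fun x => ?_
      by_cases hx : 2 * ENNReal.ofReal t < maximalFun S μ g x <;> simp [hx]
    have e2 : ∫⁻ x, (if ENNReal.ofReal t < g x then
        g x * ENNReal.ofReal (t ^ (p - 1 - 1)) else 0) ∂μ =
        ENNReal.ofReal (t ^ (p - 1 - 1)) *
          ∫⁻ x, {x | ENNReal.ofReal t < g x}.indicator g x ∂μ := by
      rw [← lintegral_const_mul _ (hg.indicator (measurableSet_lt measurable_const hg))]
      refine lintegral_congr fun x => ?_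
      by_cases hx : ENNReal.ofReal t < g x <;> simp [hx, mul_comm]
    have e3 : ENNReal.ofReal (t ^ (p - 1)) =
        ENNReal.ofReal (t ^ (p - 1 - 1)) * ENNReal.ofReal t := by
      rw [← ENNReal.ofReal_mul (by positivity), ← Real.rpow_add_one ht0.ne', sub_add_cancel]
    rw [e1, e2, e3, mul_assoc]
    gcongr
    exact mul_measure_lt_maximalFun_le hS hnest hfin g ENNReal.ofReal_ne_top
  calc ∫⁻ x, maximalFun S μ g x ^ p ∂μ
      = 2 ^ p * ENNReal.ofReal p * ∫⁻ x, ∫⁻ t in Set.Ioi (0 : ℝ),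
          (if 2 * ENNReal.ofReal t < maximalFun S μ g x then
            ENNReal.ofReal (t ^ (p - 1)) else 0) ∂volume ∂μ := by
        rw [lintegral_congr hpt]
        exact lintegral_const_mul _ hmeas1.lintegral_prod_right'
    _ = 2 ^ p * ENNReal.ofReal p * ∫⁻ t in Set.Ioi (0 : ℝ), ∫⁻ x,
          (if 2 * ENNReal.ofReal t < maximalFun S μ g x then
            ENNReal.ofReal (t ^ (p - 1)) else 0) ∂μ := by
        rw [lintegral_lintegral_swap hmeas1.aemeasurable]
    _ ≤ 2 ^ p * ENNReal.ofReal p * ∫⁻ t in Set.Ioi (0 : ℝ), ∫⁻ x,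
          (if ENNReal.ofReal t < g x then
            g x * ENNReal.ofReal (t ^ (p - 1 - 1)) else 0) ∂μ := by
        gcongr 2 ^ p * ENNReal.ofReal p * ?_
        exact setLIntegral_mono' measurableSet_Ioi hlayer
    _ = 2 ^ p * ENNReal.ofReal p * ∫⁻ x, ∫⁻ t in Set.Ioi (0 : ℝ),
          (if ENNReal.ofReal t < g x then
            g x * ENNReal.ofReal (t ^ (p - 1 - 1)) else 0) ∂volume ∂μ := by
        rw [lintegral_lintegral_swap hmeas2.aemeasurable]
    _ = 2 ^ p * ENNReal.ofReal p * ∫⁻ x, g x ^ p / ENNReal.ofReal (p - 1) ∂μ := by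
        congr 1
        refine lintegral_congr fun x => ?_
        have hx : ∀ t : ℝ, (if ENNReal.ofReal t < g x then
            g x * ENNReal.ofReal (t ^ (p - 1 - 1)) else 0) = g x *
            (if ENNReal.ofReal t < g x then ENNReal.ofReal (t ^ (p - 1 - 1)) else 0) :=
          fun t => by split_ifs <;> simp
        simp only [hx]
        rw [lintegral_const_mul _ (Measurable.ite (measurableSet_lt (by fun_prop)
          measurable_const) (by fun_prop) measurable_const),
          lintegral_Ioi_ite_rpow_sub_one hp1, ← mul_div_assoc]
        congr 1
        nth_rewrite 1 [← ENNReal.rpow_one (g x)]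
        rw [← ENNReal.rpow_add_of_nonneg _ _ zero_le_one hp1.le, add_sub_cancel]
    _ = _ := by
        simp only [div_eq_mul_inv]
        rw [lintegral_mul_const _ (hg.pow_const p)]
        ring

end MaximalFunction

section Duality

variable {α : Type*} [MeasurableSpace α]

/-- Converse of Hölder's inequality. -/
lemma rpow_lintegral_rpow_le_of_forall_lintegral_mul_le {μ : Measure α} [SigmaFinite μ]
    {W : α → ℝ≥0∞} (hW : Measurable W) {s s' : ℝ} (hs : s.HolderConjugate s') {A : ℝ≥0∞}
    (h : ∀ g : α → ℝ≥0∞, Measurable g →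
      ∫⁻ x, W x * g x ∂μ ≤ A * (∫⁻ x, g x ^ s' ∂μ) ^ (1 / s')) :
    (∫⁻ x, W x ^ s ∂μ) ^ (1 / s) ≤ A := by
  have hs0 : 0 < s := hs.pos
  have hs1 : 0 < s - 1 := hs.sub_one_pos
  set V : ℕ → α → ℝ≥0∞ := fun N => (spanningSets μ N).indicator fun x => min (W x) N with hV
  have hVm : ∀ N, Measurable (V N) := fun N =>
    (hW.min measurable_const).indicator (measurableSet_spanningSets μ N)
  have hVW : ∀ N x, V N x ≤ W x := fun N x =>
    (Set.indicator_le_self _ _ _).trans (min_le_left _ _)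
  have hbound : ∀ N, (∫⁻ x, V N x ^ s ∂μ) ^ (1 / s) ≤ A := by
    intro N
    set I := ∫⁻ x, V N x ^ s ∂μ
    have hItop : I ≠ ⊤ := by
      have : I ≤ ∫⁻ x, (spanningSets μ N).indicator (fun _ => (N : ℝ≥0∞) ^ s) x ∂μ := by
        refine lintegral_mono fun x => ?_
        by_cases hx : x ∈ spanningSets μ N
        · simp only [hV, hx, Set.indicator_of_mem]
          exact ENNReal.rpow_le_rpow (min_le_right _ _) hs0.le
        · simp [hV, hx, hs0]
      rw [lintegral_indicator_const (measurableSet_spanningSets μ N)] at this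
      exact ne_top_of_le_ne_top (ENNReal.mul_ne_top
        (ENNReal.rpow_ne_top_of_nonneg hs0.le (by simp))
        (measure_spanningSets_lt_top μ N).ne) this
    rcases eq_or_ne I 0 with hI0 | hI0
    · simp [hI0, hs0]
    have h1 : I ≤ A * I ^ (1 / s') := by
      have h2 := h (fun x => V N x ^ (s - 1)) ((hVm N).pow_const _)
      have h3 : ∀ x, (V N x ^ (s - 1)) ^ s' = V N x ^ s := fun x => by
        rw [← ENNReal.rpow_mul, hs.sub_one_mul_conj]
      simp only [h3] at h2
      refine le_trans (lintegral_mono fun x => ?_) h2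
      calc V N x ^ s = V N x ^ (1 : ℝ) * V N x ^ (s - 1) := by
            rw [← ENNReal.rpow_add_of_nonneg _ _ zero_le_one hs1.le, add_sub_cancel]
        _ ≤ W x * V N x ^ (s - 1) := by
            rw [ENNReal.rpow_one]
            gcongr
            exact hVW N x
    have h4 : I = I ^ (1 / s) * I ^ (1 / s') := by
      rw [← ENNReal.rpow_add _ _ hI0 hItop, one_div, one_div, hs.inv_add_inv_eq_one,
        ENNReal.rpow_one]
    nth_rewrite 1 [h4] at h1
    refine (ENNReal.mul_le_mul_iff_left ?_ ?_).1 h1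
    · exact (ENNReal.rpow_pos (pos_iff_ne_zero.2 hI0) hItop).ne'
    · exact ENNReal.rpow_ne_top_of_nonneg (one_div_nonneg.2 hs.symm.nonneg) hItop
  have hlim : Filter.Tendsto (fun N => ∫⁻ x, V N x ^ s ∂μ) Filter.atTop
      (nhds (∫⁻ x, W x ^ s ∂μ)) := by
    refine lintegral_tendsto_of_tendsto_of_monotone
      (fun N => ((hVm N).pow_const s).aemeasurable) ?_ ?_
    · refine Filter.Eventually.of_forall fun x N M hNM => ?_
      refine ENNReal.rpow_le_rpow ?_ hs0.le
      by_cases hx : x ∈ spanningSets μ N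
      · have hx' := monotone_spanningSets μ hNM hx
        simp only [hV, hx, hx', Set.indicator_of_mem]
        gcongr
      · simp [hV, hx]
    · refine Filter.Eventually.of_forall fun x => ?_
      refine (ENNReal.continuous_rpow_const.tendsto _).comp ?_
      have ht : Filter.Tendsto (fun N : ℕ => min (W x) (N : ℝ≥0∞)) Filter.atTop
          (nhds (W x)) := by
        simpa using tendsto_const_nhds.min ENNReal.tendsto_nat_nhds_top
      refine ht.congr' ?_
      filter_upwards [Filter.eventually_ge_atTop (spanningSetsIndex μ x)] with N hN
      have hx := monotone_spanningSets μ hN (mem_spanningSetsIndex μ x)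
      simp [hV, hx]
  exact le_of_tendsto ((ENNReal.continuous_rpow_const.tendsto _).comp hlim)
    (Filter.Eventually.of_forall hbound)

end Duality

section NestedFamily

variable {α ι : Type*} [MeasurableSpace α] {S : ι → Set α}

lemma tsum_mul_rpow_average_le [Countable ι] (hS : ∀ i, MeasurableSet (S i))
    (hnest : ∀ i j, S i ⊆ S j ∨ S j ⊆ S i ∨ Disjoint (S i) (S j)) {μ : Measure α} [SFinite μ]
    (hfin : ∀ i, μ (S i) ≠ ⊤) {q : ℝ} (hq : 1 < q) (a : ι → ℝ≥0∞) :
    ∑' i, a i * μ (S i) *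
      ((∑' j, if S j ⊆ S i then a j * μ (S j) else 0) / μ (S i)) ^ (q - 1) ≤
    (2 ^ q * (ENNReal.ofReal q / ENNReal.ofReal (q - 1))) ^ ((q - 1) / q) *
      ∫⁻ x, (∑' i, (S i).indicator (fun _ => a i) x) ^ q ∂μ := by
  have hq0 : 0 < q := by linarith
  have hq1 : 0 < q - 1 := by linarith
  have hconj : q.HolderConjugate (q / (q - 1)) := Real.HolderConjugate.conjExponent hq
  set F : α → ℝ≥0∞ := fun x => ∑' i, (S i).indicator (fun _ => a i) x
  have hFm : Measurable F := Measurable.tsum fun i => measurable_const.indicator (hS i)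
  set M := maximalFun S μ F
  have hMm : Measurable M := measurable_maximalFun hS μ F
  have hinner : ∀ i, (∑' j, if S j ⊆ S i then a j * μ (S j) else 0) ≤
      ∫⁻ x in S i, F x ∂μ := by
    intro i
    rw [lintegral_tsum fun j => (measurable_const.indicator (hS j)).aemeasurable]
    refine ENNReal.tsum_le_tsum fun j => ?_
    split_ifs with hji
    · rw [lintegral_indicator_const (hS j), Measure.restrict_apply (hS j),
        Set.inter_eq_left.2 hji]
    · exact zero_le
  have hterm : ∀ i, a i * μ (S i) *
      ((∑' j, if S j ⊆ S i then a j * μ (S j) else 0) / μ (S i)) ^ (q - 1) ≤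
      ∫⁻ x, (S i).indicator (fun _ => a i) x * M x ^ (q - 1) ∂μ := by
    intro i
    set d := (∑' j, if S j ⊆ S i then a j * μ (S j) else 0) / μ (S i)
    have e : a i * μ (S i) * d ^ (q - 1) =
        ∫⁻ x, (S i).indicator (fun _ => a i * d ^ (q - 1)) x ∂μ := by
      rw [lintegral_indicator_const (hS i)]
      ring
    rw [e]
    refine lintegral_mono fun x => ?_
    by_cases hx : x ∈ S i
    · simp only [hx, Set.indicator_of_mem]
      gcongr
      exact (ENNReal.div_le_div_right (hinner i) _).trans (average_le_maximalFun S μ F hx)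
    · simp [hx]
  calc _ ≤ ∑' i, ∫⁻ x, (S i).indicator (fun _ => a i) x * M x ^ (q - 1) ∂μ :=
        ENNReal.tsum_le_tsum hterm
    _ = ∫⁻ x, (F * fun x => M x ^ (q - 1)) x ∂μ := by
        refine (lintegral_tsum fun i => ((measurable_const.indicator (hS i)).mul
          (hMm.pow_const _)).aemeasurable).symm.trans ?_
        exact lintegral_congr fun x => ENNReal.tsum_mul_right
    _ ≤ (∫⁻ x, F x ^ q ∂μ) ^ (1 / q) *
          (∫⁻ x, (M x ^ (q - 1)) ^ (q / (q - 1)) ∂μ) ^ (1 / (q / (q - 1))) :=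
        ENNReal.lintegral_mul_le_Lp_mul_Lq μ hconj hFm.aemeasurable
          (hMm.pow_const _).aemeasurable
    _ = (∫⁻ x, F x ^ q ∂μ) ^ (1 / q) * (∫⁻ x, M x ^ q ∂μ) ^ ((q - 1) / q) := by
        simp only [← ENNReal.rpow_mul, one_div_div, mul_div_cancel₀ q hq1.ne']
    _ ≤ (∫⁻ x, F x ^ q ∂μ) ^ (1 / q) *
          (2 ^ q * (ENNReal.ofReal q / ENNReal.ofReal (q - 1)) * ∫⁻ x, F x ^ q ∂μ) ^
            ((q - 1) / q) := by
        gcongr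
        exact lintegral_maximalFun_rpow_le hS hnest hfin hFm hq
    _ = _ := by
        rw [ENNReal.mul_rpow_of_nonneg _ _ (by positivity), mul_left_comm,
          ← ENNReal.rpow_add_of_nonneg _ _ (by positivity) (by positivity), ← add_div,
          add_sub_cancel, div_self hq0.ne', ENNReal.rpow_one]

lemma tsum_mul_rpow_mul_lintegral_le (hS : ∀ i, MeasurableSet (S i)) (σ ω : Measure α)
    (hσ : ∀ i, σ (S i) ≠ ⊤) {q : ℝ} (hq : 1 < q) (K : ι → ℝ≥0∞) (g : α → ℝ≥0∞) :
    ∑' i, K i * ω (S i) *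
      ((∑' j, if S j ⊆ S i then K j * ω (S j) * σ (S j) else 0) / ω (S i)) ^ (q - 1) *
        ∫⁻ x in S i, g x ∂σ ≤
    ∑' i, K i * (∫⁻ x in S i, maximalFun S σ g x ^ (1 / q) ∂σ) * ω (S i) *
      ((∑' j, if S j ⊆ S i then
        K j * (∫⁻ x in S j, maximalFun S σ g x ^ (1 / q) ∂σ) * ω (S j) else 0) / ω (S i)) ^
          (q - 1) := by
  have hq0 : 0 < q := by linarith
  have hq1 : 0 < q - 1 := by linarith
  refine ENNReal.tsum_le_tsum fun i => ?_
  set m := (∫⁻ x in S i, g x ∂σ) / σ (S i)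
  have hgm : ∫⁻ x in S i, g x ∂σ ≤ m * σ (S i) := by
    rcases eq_or_ne (σ (S i)) 0 with h0 | h0
    · simp [Measure.restrict_eq_zero.2 h0]
    · exact (ENNReal.div_mul_cancel h0 (hσ i)).ge
  have hf : ∀ j, S j ⊆ S i →
      σ (S j) * m ^ (1 / q) ≤ ∫⁻ x in S j, maximalFun S σ g x ^ (1 / q) ∂σ := by
    intro j hji
    rw [mul_comm, ← setLIntegral_const]
    refine setLIntegral_mono' (hS j) fun x hx => ?_
    gcongr
    exact average_le_maximalFun S σ g (hji hx)
  have hsum : (∑' j, if S j ⊆ S i then K j * ω (S j) * σ (S j) else 0) * m ^ (1 / q) ≤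
      ∑' j, if S j ⊆ S i then
        K j * (∫⁻ x in S j, maximalFun S σ g x ^ (1 / q) ∂σ) * ω (S j) else 0 := by
    rw [← ENNReal.tsum_mul_right]
    refine ENNReal.tsum_le_tsum fun j => ?_
    split_ifs with hji
    · calc K j * ω (S j) * σ (S j) * m ^ (1 / q)
          = K j * (σ (S j) * m ^ (1 / q)) * ω (S j) := by ring
        _ ≤ _ := by
          gcongr
          exact hf j hji
    · simp
  set d := ∑' j, if S j ⊆ S i then K j * ω (S j) * σ (S j) else 0
  have hmm : m = m ^ (1 / q) * (m ^ (1 / q)) ^ (q - 1) := by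
    rw [← ENNReal.rpow_mul, ← ENNReal.rpow_add_of_nonneg _ _ (by positivity) (by positivity)]
    have : 1 / q + 1 / q * (q - 1) = 1 := by field_simp; ring
    rw [this, ENNReal.rpow_one]
  calc K i * ω (S i) * (d / ω (S i)) ^ (q - 1) * ∫⁻ x in S i, g x ∂σ
      ≤ K i * ω (S i) * (d / ω (S i)) ^ (q - 1) *
          (m ^ (1 / q) * (m ^ (1 / q)) ^ (q - 1) * σ (S i)) := by
        rw [← hmm]
        gcongr
    _ = K i * (σ (S i) * m ^ (1 / q)) * ω (S i) *
          (d * m ^ (1 / q) / ω (S i)) ^ (q - 1) := by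
        rw [ENNReal.mul_div_right_comm, ENNReal.mul_rpow_of_nonneg _ _ hq1.le]
        ring
    _ ≤ _ := by
        gcongr
        exact hf i subset_rfl

end NestedFamily

section DyadicCubes

lemma mem_cube_iff {n : ℕ} {P : ℤ × (Fin n → ℤ)} {x : Fin n → ℝ} :
    x ∈ cube n P ↔ ∀ j, ⌊x j * 2 ^ P.1⌋ = P.2 j := by
  have h2 : (0 : ℝ) < 2 ^ P.1 := by positivity
  refine forall_congr' fun j => ?_
  rw [Int.floor_eq_iff, zpow_neg, ← div_eq_mul_inv, ← div_eq_mul_inv, div_le_iff₀ h2,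
    lt_div_iff₀ h2]

lemma cube_eq_pi (n : ℕ) (P : ℤ × (Fin n → ℤ)) :
    cube n P = Set.univ.pi fun j =>
      Set.Ico ((P.2 j : ℝ) * 2 ^ (-P.1)) (((P.2 j : ℝ) + 1) * 2 ^ (-P.1)) := by
  ext x
  simp [cube, dyadicCube]

lemma measurableSet_cube (n : ℕ) (P : ℤ × (Fin n → ℤ)) : MeasurableSet (cube n P) := by
  rw [cube_eq_pi]
  exact MeasurableSet.univ_pi fun j => measurableSet_Ico

lemma measure_cube_ne_top (n : ℕ) (P : ℤ × (Fin n → ℤ)) (μ : Measure (Fin n → ℝ))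
    [IsLocallyFiniteMeasure μ] : μ (cube n P) ≠ ⊤ := by
  have hsub : cube n P ⊆ Set.univ.pi fun j =>
      Set.Icc ((P.2 j : ℝ) * 2 ^ (-P.1)) (((P.2 j : ℝ) + 1) * 2 ^ (-P.1)) := by
    rw [cube_eq_pi]
    exact Set.pi_mono fun j _ => Set.Ico_subset_Icc_self
  exact ne_top_of_le_ne_top (isCompact_univ_pi fun j => isCompact_Icc).measure_lt_top.ne
    (measure_mono hsub)

lemma cube_subset_of_le {n : ℕ} {P Q : ℤ × (Fin n → ℤ)} (h : Q.1 ≤ P.1) {x : Fin n → ℝ}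
    (hxP : x ∈ cube n P) (hxQ : x ∈ cube n Q) : cube n P ⊆ cube n Q := by
  intro y hy
  rw [mem_cube_iff] at *
  have hfl : ∀ z : ℝ, ⌊z * 2 ^ Q.1⌋ = ⌊z * 2 ^ P.1⌋ / ((2 ^ (P.1 - Q.1).toNat : ℕ) : ℤ) := by
    intro z
    rw [← Int.floor_div_natCast]
    congr 1
    rw [_root_.eq_div_iff (by positivity), mul_assoc]
    congr 1
    push_cast
    rw [← zpow_natCast, ← zpow_add₀ two_ne_zero, Int.toNat_of_nonneg (sub_nonneg.2 h),
      add_sub_cancel]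
  intro j
  rw [← hxQ j, hfl, hfl, hy j, hxP j]

lemma cube_nested (n : ℕ) (P Q : ℤ × (Fin n → ℤ)) :
    cube n P ⊆ cube n Q ∨ cube n Q ⊆ cube n P ∨ Disjoint (cube n P) (cube n Q) := by
  by_cases hd : Disjoint (cube n P) (cube n Q)
  · exact Or.inr (Or.inr hd)
  obtain ⟨x, hxP, hxQ⟩ := Set.not_disjoint_iff.1 hd
  rcases le_total Q.1 P.1 with h | h
  · exact Or.inl (cube_subset_of_le h hxP hxQ)
  · exact Or.inr (Or.inl (cube_subset_of_le h hxQ hxP))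

end DyadicCubes

lemma measurable_wolffPot (n : ℕ) (K : ℤ × (Fin n → ℤ) → ℝ≥0∞) (ω σ : Measure (Fin n → ℝ))
    (q : ℝ) : Measurable (wolffPot n K ω σ q) :=
  Measurable.tsum fun P => measurable_const.indicator (measurableSet_cube n P)

lemma lintegral_wolffPot_mul (n : ℕ) (K : ℤ × (Fin n → ℤ) → ℝ≥0∞)
    (ω σ : Measure (Fin n → ℝ)) (q : ℝ) {g : (Fin n → ℝ) → ℝ≥0∞} (hg : Measurable g) :
    ∫⁻ x, wolffPot n K ω σ q x * g x ∂σ =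
      ∑' P, K P * ω (cube n P) *
        ((∑' P', if cube n P' ⊆ cube n P then K P' * ω (cube n P') * σ (cube n P') else 0) /
          ω (cube n P)) ^ (q - 1) * ∫⁻ x in cube n P, g x ∂σ := by
  simp only [wolffPot, ← ENNReal.tsum_mul_right]
  refine (lintegral_tsum fun P => ((measurable_const.indicator (measurableSet_cube n P)).mul
    hg).aemeasurable).trans ?_
  refine tsum_congr fun P => ?_
  rw [← lintegral_const_mul _ hg, ← lintegral_indicator (measurableSet_cube n P)]
  refine lintegral_congr fun x => ?_
  by_cases hx : x ∈ cube n P <;> simp [hx]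

/-- Necessity in the two weight trace theorem, upper triangle case:
the trace inequality implies `‖(W^q_{K,ω}[σ])^{1/q}‖_{L^r(dσ)} ≤ C C₁`. -/
theorem trace_inequality_necessity (n : ℕ) (p q r : ℝ)
    (hq : 1 < q) (hqp : q < p) (hr : 1 / q = 1 / r + 1 / p) :
    ∃ C : ℝ≥0∞, 0 < C ∧ C < ⊤ ∧
      ∀ (σ ω : Measure (Fin n → ℝ)), IsLocallyFiniteMeasure σ →
        IsLocallyFiniteMeasure ω → ∀ (K : ℤ × (Fin n → ℤ) → ℝ≥0∞) (C₁ : ℝ≥0∞),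
        (∀ f : (Fin n → ℝ) → ℝ≥0∞, Measurable f →
          (∫⁻ x, (∑' P : ℤ × (Fin n → ℤ),
              (cube n P).indicator (fun _ => K P * ∫⁻ y in cube n P, f y ∂σ) x) ^ q ∂ω)
            ^ (1 / q) ≤ C₁ * (∫⁻ x, f x ^ p ∂σ) ^ (1 / p)) →
        (∫⁻ x, wolffPot n K ω σ q x ^ (r / q) ∂σ) ^ (1 / r) ≤ C * C₁ := by
  have hp0 : 0 < p := by linarith
  have hq0 : 0 < q := by linarith
  have hrinv : 1 / r = 1 / q - 1 / p := by linarith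
  have hr0 : 0 < r := by
    rw [← one_div_pos, hrinv, sub_pos]
    exact one_div_lt_one_div_of_lt hq0 hqp
  have hpq : 1 < p / q := (one_lt_div hq0).2 hqp
  have hpq1 : 0 < p / q - 1 := by linarith
  have hconj : (r / q).HolderConjugate (p / q) := by
    refine Real.HolderConjugate.symm (Real.holderConjugate_iff.2 ⟨hpq, ?_⟩)
    rw [inv_div, inv_div]
    have : q * (1 / q) = q * (1 / r + 1 / p) := by rw [hr]
    field_simp at this ⊢
    linarith
  set A : ℝ≥0∞ := (2 ^ q * (ENNReal.ofReal q / ENNReal.ofReal (q - 1))) ^ ((q - 1) / q)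
  set B : ℝ≥0∞ := (2 ^ (p / q) *
    (ENNReal.ofReal (p / q) / ENNReal.ofReal (p / q - 1))) ^ (1 / (p / q))
  have hconst : ∀ s t : ℝ, 1 < s → 0 ≤ t →
      0 < (2 ^ s * (ENNReal.ofReal s / ENNReal.ofReal (s - 1))) ^ t ∧
      (2 ^ s * (ENNReal.ofReal s / ENNReal.ofReal (s - 1))) ^ t ≠ ⊤ := by
    intro s t hs ht
    have hs1 : ENNReal.ofReal (s - 1) ≠ 0 := by simpa using hs
    have hs0 : ENNReal.ofReal s ≠ 0 := by simpa using (by linarith : 0 < s)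
    have htop : 2 ^ s * (ENNReal.ofReal s / ENNReal.ofReal (s - 1)) ≠ ⊤ :=
      ENNReal.mul_ne_top (ENNReal.rpow_ne_top_of_nonneg (by linarith) (by simp))
        (ENNReal.div_ne_top ENNReal.ofReal_ne_top hs1)
    refine ⟨ENNReal.rpow_pos ?_ htop, ENNReal.rpow_ne_top_of_nonneg ht htop⟩
    exact ENNReal.mul_pos (ENNReal.rpow_pos (by simp) (by simp)).ne'
      (ENNReal.div_pos hs0 ENNReal.ofReal_ne_top).ne'
  have hA := hconst q ((q - 1) / q) hq (div_nonneg (by linarith) hq0.le)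
  have hB := hconst (p / q) (1 / (p / q)) hpq (by positivity)
  have hABtop : A * B ≠ ⊤ := ENNReal.mul_ne_top hA.2 hB.2
  refine ⟨(A * B) ^ (1 / q), ENNReal.rpow_pos (ENNReal.mul_pos hA.1.ne' hB.1.ne') hABtop,
    (ENNReal.rpow_ne_top_of_nonneg (by positivity) hABtop).lt_top, ?_⟩
  intro σ ω hσ hω K C₁ htrace
  have hpair : ∀ g : (Fin n → ℝ) → ℝ≥0∞, Measurable g →
      ∫⁻ x, wolffPot n K ω σ q x * g x ∂σ ≤
        A * B * C₁ ^ q * (∫⁻ x, g x ^ (p / q) ∂σ) ^ (1 / (p / q)) := by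
    intro g hg
    set f : (Fin n → ℝ) → ℝ≥0∞ := fun x => maximalFun (cube n) σ g x ^ (1 / q)
    have hf : Measurable f := (measurable_maximalFun (measurableSet_cube n) σ g).pow_const _
    have hT := htrace f hf
    rw [one_div q, ENNReal.rpow_inv_le_iff hq0, ENNReal.mul_rpow_of_nonneg _ _ hq0.le,
      ← ENNReal.rpow_mul] at hT
    have hfp : ∀ x, f x ^ p = maximalFun (cube n) σ g x ^ (p / q) := fun x => by
      rw [← ENNReal.rpow_mul, one_div_mul_eq_div]
    simp only [hfp] at hT
    calc ∫⁻ x, wolffPot n K ω σ q x * g x ∂σ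
        ≤ A * ∫⁻ x, (∑' P : ℤ × (Fin n → ℤ),
            (cube n P).indicator (fun _ => K P * ∫⁻ y in cube n P, f y ∂σ) x) ^ q ∂ω := by
          rw [lintegral_wolffPot_mul n K ω σ q hg]
          exact (tsum_mul_rpow_mul_lintegral_le (measurableSet_cube n) σ ω
            (fun P => measure_cube_ne_top n P σ) hq K g).trans
            (tsum_mul_rpow_average_le (measurableSet_cube n) (cube_nested n)
              (fun P => measure_cube_ne_top n P ω) hq _)
      _ ≤ A * (C₁ ^ q * (∫⁻ x, maximalFun (cube n) σ g x ^ (p / q) ∂σ) ^ (1 / p * q)) := by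
          gcongr
      _ ≤ A * (C₁ ^ q * (B * (∫⁻ x, g x ^ (p / q) ∂σ) ^ (1 / (p / q)))) := by
          rw [one_div_mul_eq_div, ← one_div_div p q, ← ENNReal.mul_rpow_of_nonneg _ _
            (by positivity : 0 ≤ 1 / (p / q))]
          gcongr
          exact lintegral_maximalFun_rpow_le (measurableSet_cube n) (cube_nested n)
            (fun P => measure_cube_ne_top n P σ) hg hpq
      _ = _ := by ring
  have hdual := rpow_lintegral_rpow_le_of_forall_lintegral_mul_le
    (measurable_wolffPot n K ω σ q) hconj hpair
  have hroot := ENNReal.rpow_le_rpow hdual (by positivity : 0 ≤ 1 / q)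
  rw [ENNReal.mul_rpow_of_nonneg _ _ (by positivity : 0 ≤ 1 / q), ← ENNReal.rpow_mul,
    ← ENNReal.rpow_mul, mul_one_div_cancel hq0.ne', ENNReal.rpow_one] at hroot
  have hexp : 1 / (r / q) * (1 / q) = 1 / r := by field_simp
  rwa [hexp] at hroot

end
end
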